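/- Suppose f : 𝔽_7^2 → {0, 1, 2, 3} is a function whose support is contained in the union of three distinct parallel lines ℓ₁, ℓ₂, ℓ₃ (three cosets of one fixed one-dimensional subspace of 𝔽_7^2), that Σ_{x∈ℓ} f(x) ≤ 7 for every line ℓ of 𝔽_7^2, and that Σ_{x∈ℓ₁} f(x) = Σ_{x∈ℓ₂} f(x) = Σ_{x∈ℓ₃} f(x) = 7. If f(x) = 3 for some x ∈ 𝔽_7^2, then f is equidistributed on at most two families of parallel lines; that is, there are at most two one-dimensional subspaces d of 𝔽_7^2 such that Σ_{x∈ℓ} f(x) is the same for all seven cosets ℓ of d. -/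

import Mathlib

open Finset

/-- The character `x ↦ e^{2πi (x·a)/p}` on `𝔽_p^d`. -/
noncomputable def chr (p : ℕ) {d : ℕ} (a x : Fin d → ZMod p) : ℂ :=
  Complex.exp (2 * (Real.pi : ℂ) * Complex.I *
    ((ZMod.val (∑ i, x i * a i) : ℕ) : ℂ) / (p : ℂ))

/-- `(E, A)` is a spectral pair: the characters `χ_a`, `a ∈ A`, restricted to `E`,
are pairwise orthogonal, span `L²(E)`, and are linearly independent, i.e. they
form an orthogonal basis of `L²(E)`. -/
def IsSpectralPair (p : ℕ) {d : ℕ} (E A : Finset (Fin d → ZMod p)) : Prop :=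
  (∀ a ∈ A, ∀ b ∈ A, a ≠ b →
    ∑ x ∈ E, chr p a x * (starRingEnd ℂ) (chr p b x) = 0) ∧
  (∀ f : E → ℂ, ∃ c : A → ℂ, ∀ x : E, f x = ∑ a : A, c a * chr p a.1 x.1) ∧
  (∀ c : A → ℂ, (∀ x : E, ∑ a : A, c a * chr p a.1 x.1 = 0) → ∀ a, c a = 0)

/-- `E` is a spectral set. -/
def IsSpectral (p : ℕ) {d : ℕ} (E : Finset (Fin d → ZMod p)) : Prop :=
  ∃ A, IsSpectralPair p E A

/-- `E` tiles `𝔽_p^d` by translation. -/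
def Tiles (p : ℕ) {d : ℕ} (E : Finset (Fin d → ZMod p)) : Prop :=
  ∃ A : Finset (Fin d → ZMod p),
    ∀ x, (∑ a ∈ A, if x - a ∈ E then (1 : ℕ) else 0) = 1

/-- `E` determines the direction (one-dimensional subspace) `D`. -/
def Determines (p : ℕ) {d : ℕ} (E : Finset (Fin d → ZMod p))
    (D : Submodule (ZMod p) (Fin d → ZMod p)) : Prop :=
  ∃ e₁ ∈ E, ∃ e₂ ∈ E, e₁ ≠ e₂ ∧ e₁ - e₂ ∈ D

/-- The Fourier transform of the indicator function of `E`. -/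
noncomputable def ftE (p : ℕ) {d : ℕ} (E : Finset (Fin d → ZMod p))
    (ξ : Fin d → ZMod p) : ℂ :=
  ((p : ℂ) ^ d)⁻¹ * ∑ x ∈ E, Complex.exp (-(2 * (Real.pi : ℂ) * Complex.I *
    ((ZMod.val (∑ i, x i * ξ i) : ℕ) : ℂ) / (p : ℂ)))

/-- The orthogonal set `S^⊥ = {x : x · y = 0 for all y ∈ S}`. -/
def perpSet (p : ℕ) {d : ℕ} (S : Submodule (ZMod p) (Fin d → ZMod p)) :
    Set (Fin d → ZMod p) :=
  {x | ∀ y ∈ S, ∑ i, x i * y i = 0}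


/-- The sum of `f` over the line `v + D` in `𝔽_7^2`. -/
noncomputable def lineSum (f : (Fin 2 → ZMod 7) → ℕ) (v : Fin 2 → ZMod 7)
    (D : Submodule (ZMod 7) (Fin 2 → ZMod 7)) : ℕ :=
  ∑ x : Fin 2 → ZMod 7, Set.indicator {y | y - v ∈ D} f x

set_option maxHeartbeats 8000000 in
lemma core_fin (t r : Fin 7) (ht0 : t ≠ 0) (ht1 : t ≠ 1) (hr0 : r ≠ 0) (hr1 : r ≠ 1)
    (a b c : Fin 7 → ℤ) (ha : ∑ x, a x = 7) (hb : ∑ x, b x = 7) (hc : ∑ x, c x = 7)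
    (h1 : ∀ x, a x + b x + c x = 3)
    (h2 : ∀ x, a x + b (x + 1) + c (x + t) = 3)
    (h3 : ∀ x, a x + b (x + r) + c (x + r * t) = 3) : a 0 = 1 := by
  simp only [Fin.sum_univ_seven] at ha hb hc
  have p0 := h1 0
  have p1 := h1 1
  have p2 := h1 2
  have p3 := h1 3
  have p4 := h1 4
  have p5 := h1 5
  have p6 := h1 6
  have q0 := h2 0
  have q1 := h2 1
  have q2 := h2 2
  have q3 := h2 3
  have q4 := h2 4
  have q5 := h2 5
  have q6 := h2 6
  have s0 := h3 0
  have s1 := h3 1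
  have s2 := h3 2
  have s3 := h3 3
  have s4 := h3 4
  have s5 := h3 5
  have s6 := h3 6
  clear h1 h2 h3
  have key : ∀ t : Fin 7, t = 0 ∨ t = 1 ∨ t = 2 ∨ t = 3 ∨ t = 4 ∨ t = 5 ∨ t = 6 := by decide
  rcases key t with rfl | rfl | rfl | rfl | rfl | rfl | rfl <;>
  first
  | exact absurd rfl ht0
  | exact absurd rfl ht1
  | rcases key r with rfl | rfl | rfl | rfl | rfl | rfl | rfl <;>
    first
    | exact absurd rfl hr0
    | exact absurd rfl hr1
    | (clear ht0 ht1 hr0 hr1 key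
       simp only [Fin.reduceAdd, Fin.reduceMul, Fin.isValue, zero_add] at *
       linarith)

abbrev V7 := Fin 2 → ZMod 7

lemma fact_prime_seven : Fact (Nat.Prime 7) := ⟨by norm_num⟩

section Helpers

attribute [local instance] fact_prime_seven

lemma eq_span_of_mem {d : Submodule (ZMod 7) V7} (hd : Module.finrank (ZMod 7) d = 1)
    {x : V7} (hx : x ∈ d) (hx0 : x ≠ 0) : Submodule.span (ZMod 7) {x} = d := by
  apply Submodule.eq_of_le_of_finrank_eq
  · rw [Submodule.span_singleton_le_iff_mem]; exact hx
  · rw [finrank_span_singleton hx0, hd]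

lemma exists_split {d d' : Submodule (ZMod 7) V7} (hd : Module.finrank (ZMod 7) d = 1)
    (hd' : Module.finrank (ZMod 7) d' = 1) (hne : d ≠ d') (x : V7) :
    ∃ y ∈ d, x - y ∈ d' := by
  have hinf : d ⊓ d' = ⊥ := by
    rw [Submodule.eq_bot_iff]
    intro y hy
    by_contra hy0
    exact hne ((eq_span_of_mem hd hy.1 hy0).symm.trans (eq_span_of_mem hd' hy.2 hy0))
  have hsum := Submodule.finrank_sup_add_finrank_inf_eq d d'
  rw [hinf, hd, hd', finrank_bot] at hsum
  have htop : d ⊔ d' = ⊤ := by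
    apply Submodule.eq_top_of_finrank_eq
    rw [Module.finrank_fin_fun]; omega
  have hx : x ∈ d ⊔ d' := by rw [htop]; trivial
  obtain ⟨y, hy, z, hz, rfl⟩ := Submodule.mem_sup.1 hx
  exact ⟨y, hy, by simpa using hz⟩

lemma lineSum_span (f : V7 → ℕ) (v g : V7) (hg : g ≠ 0) :
    lineSum f v (Submodule.span (ZMod 7) {g}) = ∑ s : ZMod 7, f (v + s • g) := by
  classical
  unfold lineSum
  have hinj : Function.Injective (fun s : ZMod 7 => v + s • g) := by
    intro s s' h
    exact smul_left_injective (ZMod 7) hg (add_left_cancel h)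
  rw [← Finset.sum_image (s := univ) (f := f) (fun a _ b _ h => hinj h)]
  simp only [Set.indicator_apply]
  rw [← Finset.sum_filter]
  congr 1
  ext x
  simp only [Set.mem_ofPred_eq, Submodule.mem_span_singleton, mem_filter, mem_univ, true_and,
    mem_image]
  constructor
  · rintro ⟨s, hs⟩; exact ⟨s, by rw [hs]; abel⟩
  · rintro ⟨s, hs⟩; exact ⟨s, by rw [← hs]; abel⟩

lemma lineSum_congr (f : V7 → ℕ) {v v' : V7} {D : Submodule (ZMod 7) V7} (h : v - v' ∈ D) :
    lineSum f v D = lineSum f v' D := by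
  unfold lineSum
  congr 1
  ext x
  congr 1
  ext y
  simp only [Set.mem_ofPred_eq]
  constructor
  · intro hy
    have := D.add_mem hy h
    simpa using this
  · intro hy
    have := D.sub_mem hy h
    simpa using this

lemma smul_mem_zero {D : Submodule (ZMod 7) V7} {w : V7} (hw : w ∉ D) {s : ZMod 7}
    (h : s • w ∈ D) : s = 0 := by
  by_contra hs
  exact hw ((D.smul_mem_iff hs).1 h)

lemma ne_of_equi (f : V7 → ℕ) (D : Submodule (ZMod 7) V7)
    (hD : Module.finrank (ZMod 7) D = 1) (v₁ v₂ v₃ : V7)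
    (h12 : v₂ - v₁ ∉ D)
    (hsupp : ∀ x, f x ≠ 0 → (x - v₁ ∈ D ∨ x - v₂ ∈ D ∨ x - v₃ ∈ D))
    (h1 : lineSum f v₁ D = 7) (he : ∀ v w : V7, lineSum f v D = lineSum f w D) : False := by
  set w := v₂ - v₁ with hw
  have hw0 : w ≠ 0 := fun h => h12 (h ▸ D.zero_mem)
  have hspan : Submodule.span (ZMod 7) {w} ≠ D := by
    intro h; exact h12 (h ▸ Submodule.mem_span_singleton_self w)
  obtain ⟨y, hy, hyD⟩ := exists_split (finrank_span_singleton hw0) hD hspan (v₃ - v₁)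
  obtain ⟨t, rfl⟩ := Submodule.mem_span_singleton.1 hy
  obtain ⟨k, hk0, hk1, hkt⟩ : ∃ k : ZMod 7, k ≠ 0 ∧ k ≠ 1 ∧ k ≠ t := by
    have key : ∀ t : ZMod 7, ∃ k : ZMod 7, k ≠ 0 ∧ k ≠ 1 ∧ k ≠ t := by decide
    exact key t
  have hz : lineSum f (v₁ + k • w) D = 0 := by
    unfold lineSum
    apply Finset.sum_eq_zero
    intro x _
    by_contra hx
    have hxm := Set.mem_of_indicator_ne_zero hx
    rw [Set.indicator_of_mem hxm] at hx
    simp only [Set.mem_ofPred_eq] at hxm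
    rcases hsupp x hx with h | h | h
    · have := D.sub_mem h hxm
      exact hk0 (smul_mem_zero h12 (by convert this using 1; abel))
    · have := D.sub_mem h hxm
      exact hk1 (sub_eq_zero.1 (smul_mem_zero h12
        (by convert this using 1; rw [sub_smul, one_smul, hw]; abel)))
    · have := D.add_mem (D.sub_mem h hxm) hyD
      exact hkt (sub_eq_zero.1 (smul_mem_zero h12
        (by convert this using 1; rw [sub_smul]; abel)))
  have := he v₁ (v₁ + k • w)
  omega

lemma sum_three (g : ZMod 7 → ℕ) (t : ZMod 7) (ht0 : t ≠ 0) (ht1 : t ≠ 1)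
    (h : ∀ y, g y ≠ 0 → y = 0 ∨ y = 1 ∨ y = t) : ∑ y, g y = g 0 + g 1 + g t := by
  rw [← Finset.sum_subset (Finset.subset_univ {0, 1, t})]
  · rw [Finset.sum_insert, Finset.sum_insert, Finset.sum_singleton, add_assoc]
    · simpa using ht1.symm
    · simpa using ht0.symm
  · intro y _ hy
    by_contra hg
    apply hy
    simpa using h y hg

set_option maxHeartbeats 800000 in
lemma no_three (f : V7 → ℕ) (D : Submodule (ZMod 7) V7)
    (hD : Module.finrank (ZMod 7) D = 1) (v₁ v₂ v₃ : V7)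
    (h12 : v₁ - v₂ ∉ D) (h13 : v₁ - v₃ ∉ D) (h23 : v₂ - v₃ ∉ D)
    (hsupp : ∀ x, f x ≠ 0 → (x - v₁ ∈ D ∨ x - v₂ ∈ D ∨ x - v₃ ∈ D))
    (h1 : lineSum f v₁ D = 7) (h2 : lineSum f v₂ D = 7) (h3 : lineSum f v₃ D = 7)
    (x₀ : V7) (hx₀ : x₀ - v₁ ∈ D) (hf3 : f x₀ = 3)
    (d₁ d₂ d₃ : Submodule (ZMod 7) V7)
    (hd₁ : Module.finrank (ZMod 7) d₁ = 1) (hd₂ : Module.finrank (ZMod 7) d₂ = 1)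
    (hd₃ : Module.finrank (ZMod 7) d₃ = 1)
    (he₁ : ∀ v w : V7, lineSum f v d₁ = lineSum f w d₁)
    (he₂ : ∀ v w : V7, lineSum f v d₂ = lineSum f w d₂)
    (he₃ : ∀ v w : V7, lineSum f v d₃ = lineSum f w d₃)
    (n12 : d₁ ≠ d₂) (n13 : d₁ ≠ d₃) (n23 : d₂ ≠ d₃) : False := by
  have h21 : v₂ - v₁ ∉ D := fun h => h12 (by simpa using D.neg_mem h)
  have hneD : ∀ d : Submodule (ZMod 7) V7, (∀ v w : V7, lineSum f v d = lineSum f w d) →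
      d ≠ D := by
    rintro d he rfl
    exact ne_of_equi f d hD v₁ v₂ v₃ h21 hsupp h1 he
  obtain ⟨w, hw, hwD⟩ := exists_split hd₁ hD (hneD _ he₁) (v₂ - x₀)
  obtain ⟨w₂, hw₂, hwD₂⟩ := exists_split hd₂ hD (hneD _ he₂) (v₂ - x₀)
  obtain ⟨w₃, hw₃, hwD₃⟩ := exists_split hd₃ hD (hneD _ he₃) (v₂ - x₀)
  have hnot : ∀ z : V7, v₂ - x₀ - z ∈ D → z ∉ D := by
    intro z hz hzD
    apply h21
    have := D.add_mem (D.add_mem hz hzD) hx₀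
    convert this using 1; abel
  have hwn := hnot w hwD
  have hnz : ∀ z : V7, z ∉ D → z ≠ 0 := fun z hz h => hz (h ▸ D.zero_mem)
  have hw0 := hnz _ hwn
  have hw20 := hnz _ (hnot _ hwD₂)
  have hw30 := hnz _ (hnot _ hwD₃)
  have hs₁ := eq_span_of_mem hd₁ hw hw0
  have hs₂ := eq_span_of_mem hd₂ hw₂ hw20
  have hs₃ := eq_span_of_mem hd₃ hw₃ hw30
  obtain ⟨u, hu⟩ : ∃ u, u = w₂ - w := ⟨_, rfl⟩
  have huD : u ∈ D := by
    have := D.sub_mem hwD hwD₂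
    rw [hu]; convert this using 1; abel
  have hu0 : u ≠ 0 := by
    intro h
    rw [hu, sub_eq_zero] at h
    exact n12 (by rw [← hs₁, ← hs₂, h])
  have hsD := eq_span_of_mem hD huD hu0
  have hw2eq : w₂ = w + u := by rw [hu]; abel
  obtain ⟨r, hr⟩ : ∃ r : ZMod 7, r • u = w₃ - w := by
    apply Submodule.mem_span_singleton.1
    rw [hsD]
    have := D.sub_mem hwD hwD₃
    convert this using 1; abel
  have hw3eq : w₃ = w + r • u := by rw [hr]; abel
  have hr0 : r ≠ 0 := by
    rintro rfl
    exact n13 (by rw [← hs₁, ← hs₃, hw3eq]; simp)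
  have hr1 : r ≠ 1 := by
    rintro rfl
    exact n23 (by rw [← hs₂, ← hs₃, hw3eq, hw2eq]; simp)
  obtain ⟨y, hy, hyD⟩ := exists_split hd₁ hD (hneD _ he₁) (v₃ - x₀)
  rw [← hs₁] at hy
  obtain ⟨t, rfl⟩ := Submodule.mem_span_singleton.1 hy
  have ht0 : t ≠ 0 := by
    rintro rfl
    apply h13
    have := D.neg_mem (D.add_mem hyD hx₀)
    convert this using 1; rw [zero_smul]; abel
  have ht1 : t ≠ 1 := by
    rintro rfl
    apply h23
    have := D.sub_mem hwD hyD
    convert this using 1; rw [one_smul]; abel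
  have hS : ∀ x y : ZMod 7, f (x₀ + x • u + y • w) ≠ 0 → y = 0 ∨ y = 1 ∨ y = t := by
    intro x y hxy
    have hxu := D.smul_mem x huD
    rcases hsupp _ hxy with h | h | h
    · left
      apply smul_mem_zero hwn
      have := D.sub_mem (D.sub_mem h hxu) hx₀
      convert this using 1; abel
    · right; left
      apply sub_eq_zero.1
      apply smul_mem_zero hwn
      have := D.add_mem (D.sub_mem h hxu) hwD
      convert this using 1; rw [sub_smul, one_smul]; abel
    · right; right
      apply sub_eq_zero.1
      apply smul_mem_zero hwn
      have := D.add_mem (D.sub_mem h hxu) hyD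
      convert this using 1; rw [sub_smul]; abel
  -- row sums
  have row : ∀ (v : V7) (y : ZMod 7), v - (x₀ + y • w) ∈ D → lineSum f v D = 7 →
      ∑ x : ZMod 7, f (x₀ + x • u + y • w) = 7 := by
    intro v y hv h7
    refine Eq.trans ?_ h7
    rw [lineSum_congr f hv, ← hsD, lineSum_span f _ u hu0]
    refine Finset.sum_congr rfl fun x _ => ?_
    rw [add_right_comm]
  have r0 := row v₁ 0 (by convert D.neg_mem hx₀ using 1; rw [zero_smul]; abel) h1
  have r1 := row v₂ 1 (by convert hwD using 1; rw [one_smul]; abel) h2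
  have rt := row v₃ t (by convert hyD using 1; abel) h3
  -- column sums
  have col : ∀ (m : ZMod 7) (d : Submodule (ZMod 7) V7),
      Submodule.span (ZMod 7) {w + m • u} = d → w + m • u ≠ 0 →
      (∀ v w : V7, lineSum f v d = lineSum f w d) →
      ∀ x : ZMod 7, f (x₀ + x • u + (0 : ZMod 7) • w) + f (x₀ + (x + m) • u + (1 : ZMod 7) • w)
        + f (x₀ + (x + m * t) • u + t • w) = 3 := by
    intro m d hd hm he
    have hc : ∀ x : ZMod 7, lineSum f (x₀ + x • u) d =
        f (x₀ + x • u + (0 : ZMod 7) • w) + f (x₀ + (x + m) • u + (1 : ZMod 7) • w)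
        + f (x₀ + (x + m * t) • u + t • w) := by
      intro x
      rw [← hd, lineSum_span f _ _ hm]
      have e : ∀ s : ZMod 7, x₀ + x • u + s • (w + m • u) = x₀ + (x + m * s) • u + s • w := by
        intro s; module
      simp only [e]
      rw [sum_three (fun s => f (x₀ + (x + m * s) • u + s • w)) t ht0 ht1
        (fun y hy => hS _ _ hy)]
      simp only [mul_zero, add_zero, mul_one]
    have htot : ∑ x : ZMod 7, lineSum f (x₀ + x • u) d = 21 := by
      simp only [hc, Finset.sum_add_distrib]
      have q1 : ∑ x : ZMod 7, f (x₀ + (x + m) • u + (1 : ZMod 7) • w) = 7 :=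
        (Equiv.sum_comp (Equiv.addRight m)
          (fun x : ZMod 7 => f (x₀ + x • u + (1 : ZMod 7) • w))).trans r1
      have q2 : ∑ x : ZMod 7, f (x₀ + (x + m * t) • u + t • w) = 7 :=
        (Equiv.sum_comp (Equiv.addRight (m * t))
          (fun x : ZMod 7 => f (x₀ + x • u + t • w))).trans rt
      rw [r0, q1, q2]
    intro x
    rw [← hc]
    have hcst : ∀ x' : ZMod 7, lineSum f (x₀ + x' • u) d = lineSum f (x₀ + x • u) d :=
      fun x' => he _ _
    simp only [hcst, Finset.sum_const, Finset.card_univ, ZMod.card, smul_eq_mul] at htot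
    omega
  have c1 := col 0 d₁ (by simpa using hs₁) (by simpa using hw0) he₁
  have c2 := col 1 d₂ (by simpa [← hw2eq] using hs₂) (by simpa [← hw2eq] using hw20) he₂
  have c3 := col r d₃ (by simpa [← hw3eq] using hs₃) (by simpa [← hw3eq] using hw30) he₃
  simp only [zero_mul, add_zero, one_mul] at c1 c2
  have := core_fin t r ht0 ht1 hr0 hr1
    (fun x : ZMod 7 => (f (x₀ + x • u + (0 : ZMod 7) • w) : ℤ))
    (fun x : ZMod 7 => (f (x₀ + x • u + (1 : ZMod 7) • w) : ℤ))
    (fun x : ZMod 7 => (f (x₀ + x • u + t • w) : ℤ))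
    (by exact_mod_cast r0) (by exact_mod_cast r1) (by exact_mod_cast rt)
    (fun x => by exact_mod_cast c1 x) (fun x => by exact_mod_cast c2 x)
    (fun x => by exact_mod_cast c3 x)
  have h0 : f (x₀ + (0 : ZMod 7) • u + (0 : ZMod 7) • w) = 1 :=
    Int.ofNat.inj this
  rw [zero_smul, zero_smul, add_zero, add_zero] at h0
  omega

end Helpers

/-- Suppose `f : 𝔽_7^2 → {0,1,2,3}` is supported on three distinct parallel
lines `ℓ₁, ℓ₂, ℓ₃`, sums to at most `7` on every line, and sums to exactly `7`
on each of `ℓ₁, ℓ₂, ℓ₃`.  If `f(x) = 3` for some `x`, then `f` is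
equidistributed on at most two families of parallel lines. -/
theorem equidistributed_on_at_most_two_families (f : (Fin 2 → ZMod 7) → ℕ)
    (hf : ∀ x, f x ≤ 3)
    (D : Submodule (ZMod 7) (Fin 2 → ZMod 7))
    (hD : Module.finrank (ZMod 7) D = 1)
    (v₁ v₂ v₃ : Fin 2 → ZMod 7)
    (h12 : v₁ - v₂ ∉ D) (h13 : v₁ - v₃ ∉ D) (h23 : v₂ - v₃ ∉ D)
    (hsupp : ∀ x, f x ≠ 0 → (x - v₁ ∈ D ∨ x - v₂ ∈ D ∨ x - v₃ ∈ D))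
    (hle : ∀ (v : Fin 2 → ZMod 7) (D' : Submodule (ZMod 7) (Fin 2 → ZMod 7)),
      Module.finrank (ZMod 7) D' = 1 → lineSum f v D' ≤ 7)
    (h1 : lineSum f v₁ D = 7) (h2 : lineSum f v₂ D = 7) (h3 : lineSum f v₃ D = 7)
    (h3pt : ∃ x, f x = 3) :
    {d : Submodule (ZMod 7) (Fin 2 → ZMod 7) |
      Module.finrank (ZMod 7) d = 1 ∧
      ∀ v w : Fin 2 → ZMod 7, lineSum f v d = lineSum f w d}.ncard ≤ 2 := by
  by_contra hcon
  push Not at hcon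
  have hfin := Set.finite_of_ncard_pos (lt_trans (by norm_num) hcon)
  obtain ⟨d₁, d₂, d₃, ⟨a1, e1⟩, ⟨a2, e2⟩, ⟨a3, e3⟩, n12, n13, n23⟩ :=
    (Set.two_lt_ncard_iff hfin).1 hcon
  obtain ⟨x₀, hx₀⟩ := h3pt
  have sw : ∀ {a b : Fin 2 → ZMod 7}, a - b ∉ D → b - a ∉ D :=
    fun h h' => h (by simpa using D.neg_mem h')
  rcases hsupp x₀ (by omega) with h | h | h
  · exact no_three f D hD v₁ v₂ v₃ h12 h13 h23 hsupp h1 h2 h3 x₀ h hx₀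
      d₁ d₂ d₃ a1 a2 a3 e1 e2 e3 n12 n13 n23
  · exact no_three f D hD v₂ v₁ v₃ (sw h12) h23 h13
      (fun x hx => by rcases hsupp x hx with h | h | h <;> simp only [h, true_or, or_true]) h2 h1 h3 x₀ h hx₀
      d₁ d₂ d₃ a1 a2 a3 e1 e2 e3 n12 n13 n23
  · exact no_three f D hD v₃ v₁ v₂ (sw h13) (sw h23) h12
      (fun x hx => by rcases hsupp x hx with h | h | h <;> simp only [h, true_or, or_true]) h3 h1 h2 x₀ h hx₀
      d₁ d₂ d₃ a1 a2 a3 e1 e2 e3 n12 n13 n23
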